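/- Let X ⊆ ℝ⁸ be a Cayley subspace, let W ⊆ ℝ⁸ be a 6-dimensional subspace, let B ⊆ X ∩ W be a 3-dimensional subspace, and let u ∈ X be a unit vector orthogonal to B. Then u is orthogonal to W if and only if for every pair of orthonormal vectors a, b ∈ B and every orthonormal basis (g₁,g₂,g₃,g₄) of the orthogonal complement of the span of {a,b} inside W, Φ₀(g₁,g₂,g₃,g₄) = 0. (The displayed condition expresses that the 2-form ω = −∗_W(Φ₀|_W) on W vanishes on B; this is the pointwise linear-algebra core of the lemma that a Cayley submanifold with boundary in an oriented 6-dimensional scaffold W meets W orthogonally if and only if ω restricts to zero on the boundary.) -/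

import Mathlib

open scoped RealInnerProductSpace

noncomputable section

abbrev E8 := EuclideanSpace ℝ (Fin 8)

/-- The 4-form `dx_{ijkl}` on `ℝ⁸`. -/
def dx4 (i j k l : Fin 8) (v : Fin 4 → E8) : ℝ :=
  Matrix.det (Matrix.of fun r s : Fin 4 => v s (![i, j, k, l] r))

/-- The Cayley 4-form `Φ₀` on `ℝ⁸`. -/
def Phi0 (v : Fin 4 → E8) : ℝ :=
  dx4 0 1 2 3 v + dx4 0 1 4 5 v - dx4 0 1 6 7 v + dx4 0 2 4 6 v + dx4 0 2 5 7 v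
    + dx4 0 3 4 7 v - dx4 0 3 5 6 v - dx4 1 2 4 7 v + dx4 1 2 5 6 v + dx4 1 3 4 6 v
    + dx4 1 3 5 7 v - dx4 2 3 4 5 v + dx4 2 3 6 7 v + dx4 4 5 6 7 v

/-- The Cayley form applied to four vectors. -/
def Phi (a b c d : E8) : ℝ := Phi0 ![a, b, c, d]

/-- The `i`-th standard basis vector of `ℝ⁸`. -/
def stdB (i : Fin 8) : E8 := EuclideanSpace.single i 1

/-- The triple cross product: the unique vector with `⟪x, u×v×w⟫ = Φ₀(x,u,v,w)`
for all `x`. -/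
def crossTriple (u v w : E8) : E8 :=
  (EuclideanSpace.equiv (Fin 8) ℝ).symm fun i => Phi (stdB i) u v w

/-- A 4-dimensional subspace of `ℝ⁸` is Cayley if it has an orthonormal basis on which
`Φ₀` takes the value `1`. -/
def IsCayley (V : Submodule ℝ E8) : Prop :=
  Module.finrank ℝ V = 4 ∧
    ∃ v : Fin 4 → E8, (∀ i, v i ∈ V) ∧ Orthonormal ℝ v ∧ Phi0 v = 1

/-- The matrix of the skew endomorphism `v ↦ a × b × v` of `ℝ⁸`. -/
def crossMatrix (a b : E8) : Matrix (Fin 8) (Fin 8) ℝ :=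
  let p := fun i j : Fin 8 => a i * b j - a j * b i
  !![0, p 2 3 + p 4 5 - p 6 7, -p 1 3 + p 4 6 + p 5 7, p 1 2 + p 4 7 - p 5 6,
      -p 1 5 - p 2 6 - p 3 7, p 1 4 - p 2 7 + p 3 6, p 1 7 + p 2 4 - p 3 5, -p 1 6 + p 2 5 + p 3 4;
    -p 2 3 - p 4 5 + p 6 7, 0, p 0 3 - p 4 7 + p 5 6, -p 0 2 + p 4 6 + p 5 7,
      p 0 5 + p 2 7 - p 3 6, -p 0 4 - p 2 6 - p 3 7, -p 0 7 + p 2 5 + p 3 4, p 0 6 - p 2 4 + p 3 5;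
    p 1 3 - p 4 6 - p 5 7, -p 0 3 + p 4 7 - p 5 6, 0, p 0 1 - p 4 5 + p 6 7,
      p 0 6 - p 1 7 + p 3 5, p 0 7 + p 1 6 - p 3 4, -p 0 4 - p 1 5 - p 3 7, -p 0 5 + p 1 4 + p 3 6;
    -p 1 2 - p 4 7 + p 5 6, p 0 2 - p 4 6 - p 5 7, -p 0 1 + p 4 5 - p 6 7, 0,
      p 0 7 + p 1 6 - p 2 5, -p 0 6 + p 1 7 + p 2 4, p 0 5 - p 1 4 + p 2 7, -p 0 4 - p 1 5 - p 2 6;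
    p 1 5 + p 2 6 + p 3 7, -p 0 5 - p 2 7 + p 3 6, -p 0 6 + p 1 7 - p 3 5, -p 0 7 - p 1 6 + p 2 5,
      0, p 0 1 - p 2 3 + p 6 7, p 0 2 + p 1 3 - p 5 7, p 0 3 - p 1 2 + p 5 6;
    -p 1 4 + p 2 7 - p 3 6, p 0 4 + p 2 6 + p 3 7, -p 0 7 - p 1 6 + p 3 4, p 0 6 - p 1 7 - p 2 4,
      -p 0 1 + p 2 3 - p 6 7, 0, -p 0 3 + p 1 2 + p 4 7, p 0 2 + p 1 3 - p 4 6;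
    -p 1 7 - p 2 4 + p 3 5, p 0 7 - p 2 5 - p 3 4, p 0 4 + p 1 5 + p 3 7, -p 0 5 + p 1 4 - p 2 7,
      -p 0 2 - p 1 3 + p 5 7, p 0 3 - p 1 2 - p 4 7, 0, -p 0 1 + p 2 3 + p 4 5;
    p 1 6 - p 2 5 - p 3 4, -p 0 6 + p 2 4 - p 3 5, p 0 5 - p 1 4 - p 3 6, p 0 4 + p 1 5 + p 2 6,
      -p 0 3 + p 1 2 - p 5 6, -p 0 2 - p 1 3 + p 4 6, p 0 1 - p 2 3 - p 4 5, 0]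

lemma dx4_eq (i j k l : Fin 8) (a b c d : E8) :
    dx4 i j k l ![a, b, c, d] =
      (a i * b j - a j * b i) * (c k * d l - c l * d k)
      - (a i * b k - a k * b i) * (c j * d l - c l * d j)
      + (a i * b l - a l * b i) * (c j * d k - c k * d j)
      + (a j * b k - a k * b j) * (c i * d l - c l * d i)
      - (a j * b l - a l * b j) * (c i * d k - c k * d i)
      + (a k * b l - a l * b k) * (c i * d j - c j * d i) := by
  rw [dx4, Matrix.det_succ_row_zero]
  simp [Fin.sum_univ_succ, Matrix.det_fin_three, Fin.succAbove]
  ring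

lemma Phi_eq_dotProduct (x a b v : E8) :
    Phi x a b v = x.ofLp ⬝ᵥ (crossMatrix a b).mulVec v.ofLp := by
  simp only [Phi, Phi0, dx4_eq, crossMatrix, Matrix.mulVec, dotProduct, Fin.sum_univ_eight,
    Matrix.of_apply, Matrix.cons_val]
  ring

set_option maxHeartbeats 2000000 in
lemma crossMatrix_transpose_mul_self (a b : E8) :
    (crossMatrix a b).transpose * crossMatrix a b =
      ((a.ofLp ⬝ᵥ a.ofLp) * (b.ofLp ⬝ᵥ b.ofLp) - (a.ofLp ⬝ᵥ b.ofLp) ^ 2) • 1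
      - (b.ofLp ⬝ᵥ b.ofLp) • Matrix.vecMulVec a.ofLp a.ofLp
      - (a.ofLp ⬝ᵥ a.ofLp) • Matrix.vecMulVec b.ofLp b.ofLp
      + (a.ofLp ⬝ᵥ b.ofLp) •
        (Matrix.vecMulVec a.ofLp b.ofLp + Matrix.vecMulVec b.ofLp a.ofLp) := by
  ext i j
  simp only [Matrix.mul_apply, Matrix.transpose_apply, Matrix.add_apply, Matrix.sub_apply,
    Matrix.smul_apply, Matrix.one_apply, Matrix.vecMulVec_apply, smul_eq_mul, dotProduct,
    Fin.sum_univ_eight, crossMatrix, Matrix.of_apply]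
  fin_cases i <;> fin_cases j <;>
    (simp [Matrix.cons_val]; ring)

/-- The Cayley form as an alternating map. -/
def PhiAlternating : E8 [⋀^Fin 4]→ₗ[ℝ] ℝ :=
  let dx := fun i j k l : Fin 8 => (Matrix.detRowAlternating (R := ℝ) (n := Fin 4)).compLinearMap
    (LinearMap.pi fun r => (EuclideanSpace.projₗ (![i, j, k, l] r) : E8 →ₗ[ℝ] ℝ))
  dx 0 1 2 3 + dx 0 1 4 5 - dx 0 1 6 7 + dx 0 2 4 6 + dx 0 2 5 7
    + dx 0 3 4 7 - dx 0 3 5 6 - dx 1 2 4 7 + dx 1 2 5 6 + dx 1 3 4 6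
    + dx 1 3 5 7 - dx 2 3 4 5 + dx 2 3 6 7 + dx 4 5 6 7

lemma PhiAlternating_apply (v : Fin 4 → E8) : PhiAlternating v = Phi0 v := by
  have h : ∀ i j k l : Fin 8, (Matrix.detRowAlternating (R := ℝ) (n := Fin 4)).compLinearMap
      (LinearMap.pi fun r => (EuclideanSpace.projₗ (![i, j, k, l] r) : E8 →ₗ[ℝ] ℝ)) v =
      dx4 i j k l v := by
    intro i j k l
    rw [dx4, ← Matrix.det_transpose]
    rfl
  simp only [PhiAlternating, AlternatingMap.add_apply, AlternatingMap.sub_apply, h, Phi0]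

lemma Phi_swap_left (a b c d : E8) : Phi b a c d = -Phi a b c d := by
  simp only [Phi, Phi0, dx4_eq]; ring

lemma Phi_swap_mid (a b c d : E8) : Phi a c b d = -Phi a b c d := by
  simp only [Phi, Phi0, dx4_eq]; ring

lemma Phi_swap_right (a b c d : E8) : Phi a b d c = -Phi a b c d := by
  simp only [Phi, Phi0, dx4_eq]; ring

lemma inner_eq_dotProduct (x y : E8) : (⟪x, y⟫ : ℝ) = x.ofLp ⬝ᵥ y.ofLp := by
  rw [EuclideanSpace.inner_eq_star_dotProduct, star_trivial, dotProduct_comm]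

lemma crossTriple_ofLp (a b v : E8) :
    (crossTriple a b v).ofLp = (crossMatrix a b).mulVec v.ofLp := by
  ext i
  change Phi (stdB i) a b v = _
  rw [Phi_eq_dotProduct]
  simp [stdB]

lemma inner_crossTriple (x a b v : E8) : (⟪x, crossTriple a b v⟫ : ℝ) = Phi x a b v := by
  rw [inner_eq_dotProduct, crossTriple_ofLp, Phi_eq_dotProduct]

lemma Phi_add_smul_left (x y a b c : E8) (t : ℝ) :
    Phi (x + t • y) a b c = Phi x a b c + t * Phi y a b c := by
  simp only [← inner_crossTriple, inner_add_left, real_inner_smul_left]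

lemma Phi_add_smul_second (x y a b c : E8) (t : ℝ) :
    Phi a (x + t • y) b c = Phi a x b c + t * Phi a y b c := by
  rw [Phi_swap_left, Phi_add_smul_left, Phi_swap_left a x, Phi_swap_left a y]; ring

lemma Phi_add_smul_third (x y a b c : E8) (t : ℝ) :
    Phi a b (x + t • y) c = Phi a b x c + t * Phi a b y c := by
  rw [Phi_swap_mid, Phi_add_smul_second, Phi_swap_mid a b x, Phi_swap_mid a b y]; ring

lemma Phi_add_smul_right (x y a b c : E8) (t : ℝ) :
    Phi a b c (x + t • y) = Phi a b c x + t * Phi a b c y := by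
  rw [Phi_swap_right, Phi_add_smul_third, Phi_swap_right a b c x, Phi_swap_right a b c y]; ring

lemma Phi_self_left (a c d : E8) : Phi a a c d = 0 := by
  linarith [Phi_swap_left a a c d]

lemma Phi_self_mid (a b d : E8) : Phi a b b d = 0 := by
  linarith [Phi_swap_mid a b b d]

lemma Phi_self_right (a b c : E8) : Phi a b c c = 0 := by
  linarith [Phi_swap_right a b c c]

/-- For orthonormal `a, b`, the map `v ↦ a × b × v` is isometric on `{a, b}ᗮ`. -/
lemma inner_crossTriple_crossTriple {a b v : E8} (ha : ‖a‖ = 1) (hb : ‖b‖ = 1)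
    (hab : (⟪a, b⟫ : ℝ) = 0) (hav : (⟪a, v⟫ : ℝ) = 0) (hbv : (⟪b, v⟫ : ℝ) = 0) (w : E8) :
    (⟪crossTriple a b v, crossTriple a b w⟫ : ℝ) = ⟪v, w⟫ := by
  have haa : (⟪a, a⟫ : ℝ) = 1 := by rw [real_inner_self_eq_norm_sq, ha]; norm_num
  have hbb : (⟪b, b⟫ : ℝ) = 1 := by rw [real_inner_self_eq_norm_sq, hb]; norm_num
  rw [inner_eq_dotProduct] at hab hav hbv haa hbb ⊢
  rw [inner_eq_dotProduct, crossTriple_ofLp, crossTriple_ofLp, Matrix.dotProduct_mulVec,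
    Matrix.vecMul_mulVec, crossMatrix_transpose_mul_self, hab, haa, hbb,
    ← Matrix.mulVec_transpose]
  simp [Matrix.sub_mulVec, Matrix.vecMulVec_mulVec, hav, hbv]

/-- Orthonormal quadruples spanning a Cayley subspace, up to orientation. -/
def IsCayleyFrame (f : Fin 4 → E8) : Prop :=
  Orthonormal ℝ f ∧ |Phi0 f| = 1

lemma IsCayleyFrame.comp_perm {f : Fin 4 → E8} (hf : IsCayleyFrame f) (σ : Equiv.Perm (Fin 4)) :
    IsCayleyFrame (f ∘ σ) := by
  refine ⟨hf.1.comp σ σ.injective, ?_⟩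
  rw [← PhiAlternating_apply, AlternatingMap.map_perm, PhiAlternating_apply, ← hf.2]
  rcases Int.units_eq_one_or (Equiv.Perm.sign σ) with h | h <;> simp [h]

lemma exists_orthonormalBasis_coe_eq {V ι : Type*} [NormedAddCommGroup V] [InnerProductSpace ℝ V]
    [FiniteDimensional ℝ V] [Fintype ι] [Nonempty ι] {v : ι → V} (hv : Orthonormal ℝ v)
    (hcard : Fintype.card ι = Module.finrank ℝ V) :
    ∃ b : OrthonormalBasis ι ℝ V, ⇑b = v := by
  have h := coe_basisOfOrthonormalOfCardEqFinrank hv hcard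
  refine ⟨(basisOfOrthonormalOfCardEqFinrank hv hcard).toOrthonormalBasis (by rwa [h]), ?_⟩
  rw [Module.Basis.coe_toOrthonormalBasis, h]

lemma IsCayley.isCayleyFrame {X : Submodule ℝ E8} (hX : IsCayley X) {f : Fin 4 → E8}
    (hfX : ∀ i, f i ∈ X) (hf : Orthonormal ℝ f) : IsCayleyFrame f := by
  obtain ⟨hdim, v, hvX, hv, hv1⟩ := hX
  have key : ∀ g : Fin 4 → E8, (∀ i, g i ∈ X) → Orthonormal ℝ g →
      ∃ b : OrthonormalBasis (Fin 4) ℝ X, ∀ i, (b i : E8) = g i := by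
    intro g hgX hg
    obtain ⟨b, hb⟩ := exists_orthonormalBasis_coe_eq (V := X) (v := fun i => ⟨g i, hgX i⟩)
      (X.subtypeₗᵢ.orthonormal_comp_iff.mp hg) (by simp [hdim])
    exact ⟨b, fun i => by rw [hb]⟩
  obtain ⟨b, hb⟩ := key v hvX hv
  obtain ⟨c, hc⟩ := key f hfX hf
  refine ⟨hf, ?_⟩
  have hdet := AlternatingMap.eq_smul_basis_det b.toBasis (PhiAlternating.compLinearMap X.subtype)
  have h := congrArg (fun F => F c) hdet
  simp only [AlternatingMap.compLinearMap_apply, AlternatingMap.smul_apply, Submodule.subtype_apply,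
    OrthonormalBasis.coe_toBasis, hb, hc, PhiAlternating_apply, hv1] at h
  rw [h]
  rcases b.det_to_matrix_orthonormalBasis_real c with h' | h' <;> simp [h']

lemma IsCayleyFrame.Phi_eq_zero {f : Fin 4 → E8} (hf : IsCayleyFrame f) {w : E8}
    (hw : ∀ i, (⟪w, f i⟫ : ℝ) = 0) (i j k : Fin 4) : Phi w (f i) (f j) (f k) = 0 := by
  have key : ∀ g : Fin 4 → E8, IsCayleyFrame g → (∀ i, (⟪w, g i⟫ : ℝ) = 0) →
      Phi w (g 1) (g 2) (g 3) = 0 := by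
    intro g ⟨hg, hg1⟩ hw
    have hsq : Phi0 g * Phi0 g = 1 := by rw [← abs_mul_abs_self, hg1]; norm_num
    have hin : (⟪g 0, crossTriple (g 1) (g 2) (g 3)⟫ : ℝ) = Phi0 g := by
      rw [inner_crossTriple, Phi]; congr 1; ext i : 1; fin_cases i <;> rfl
    have h0 : crossTriple (g 1) (g 2) (g 3) - Phi0 g • g 0 = 0 := by
      rw [← inner_self_eq_zero (𝕜 := ℝ), inner_sub_left, inner_sub_right, inner_sub_right,
        inner_crossTriple_crossTriple (hg.1 1) (hg.1 2) (hg.2 (by decide)) (hg.2 (by decide))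
          (hg.2 (by decide)), inner_smul_right, inner_smul_right, real_inner_smul_left,
        real_inner_smul_left, real_inner_comm (g 0) (crossTriple _ _ _), hin,
        real_inner_self_eq_norm_sq, real_inner_self_eq_norm_sq, hg.1, hg.1]
      linear_combination -hsq
    rw [← inner_crossTriple, sub_eq_zero.mp h0, inner_smul_right, hw, mul_zero]
  by_cases hij : i = j
  · rw [hij, Phi_self_mid]
  by_cases hjk : j = k
  · rw [hjk, Phi_self_right]
  by_cases hik : i = k
  · rw [hik, Phi_swap_right, Phi_self_mid, neg_zero]
  obtain ⟨σ, h1, h2, h3⟩ : ∃ σ : Equiv.Perm (Fin 4), σ 1 = i ∧ σ 2 = j ∧ σ 3 = k := by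
    revert i j k; decide
  simpa [h1, h2, h3] using key _ (hf.comp_perm σ) fun i => hw (σ i)

/-- A unit vector `w` normal to a Cayley frame `f` completes it to the orthonormal basis
`f 0, f 1, f 2, f 3, w, f 0 × w × f 1, f 0 × w × f 2, f 0 × w × f 3`. -/
lemma IsCayleyFrame.exists_orthonormalBasis {f : Fin 4 → E8} (hf : IsCayleyFrame f) {w : E8}
    (hw : ∀ i, (⟪w, f i⟫ : ℝ) = 0) (hw1 : ‖w‖ = 1) :
    ∃ b : OrthonormalBasis (Fin 4 ⊕ Fin 4) ℝ E8, ⇑b = Sum.elim f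
      (Fin.cons w fun i : Fin 3 => crossTriple (f 0) w (f i.succ)) := by
  have hJ : ∀ i : Fin 3, ∀ x, (⟪crossTriple (f 0) w (f i.succ), crossTriple (f 0) w x⟫ : ℝ) =
      ⟪f i.succ, x⟫ := fun i x =>
    inner_crossTriple_crossTriple (hf.1.1 0) hw1 (by rw [real_inner_comm, hw])
      (hf.1.2 (Fin.succ_ne_zero i).symm) (hw _) x
  have hJf : ∀ k : Fin 4, ∀ i : Fin 3, (⟪f k, crossTriple (f 0) w (f i.succ)⟫ : ℝ) = 0 := by
    intro k i
    rw [inner_crossTriple, Phi_swap_mid, Phi_swap_left, hf.Phi_eq_zero hw]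
    simp
  have hJw : ∀ i : Fin 3, (⟪w, crossTriple (f 0) w (f i.succ)⟫ : ℝ) = 0 := by
    intro i
    rw [inner_crossTriple, Phi_swap_mid, Phi_self_left, neg_zero]
  refine exists_orthonormalBasis_coe_eq ?_ (by simp)
  have hff := orthonormal_iff_ite.mp hf.1
  rw [orthonormal_iff_ite]
  have hww : (⟪w, w⟫ : ℝ) = 1 := by rw [real_inner_self_eq_norm_sq, hw1]; norm_num
  rintro (i | i) (j | j)
  · simpa using hff i j
  · refine Fin.cases ?_ (fun j => ?_) j
    · simpa [real_inner_comm] using hw i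
    · simpa using hJf i j
  · refine Fin.cases ?_ (fun i => ?_) i
    · simpa using hw j
    · simpa [real_inner_comm] using hJf j i
  · refine Fin.cases ?_ (fun i => ?_) i <;> refine Fin.cases ?_ (fun j => ?_) j
    · simpa using hww
    · simpa [(Fin.succ_ne_zero j).symm] using hJw j
    · simpa [real_inner_comm] using hJw i
    · simpa [hff] using hJ i (f j.succ)

lemma IsCayleyFrame.Phi_normal_eq_zero {f : Fin 4 → E8} (hf : IsCayleyFrame f) {w₁ w₂ w₃ : E8}
    (h₁ : ∀ i, (⟪w₁, f i⟫ : ℝ) = 0) (h₂ : ∀ i, (⟪w₂, f i⟫ : ℝ) = 0)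
    (h₃ : ∀ i, (⟪w₃, f i⟫ : ℝ) = 0) (i : Fin 4) : Phi (f i) w₁ w₂ w₃ = 0 := by
  wlog hi : i = 0 generalizing f i
  · simpa using this (hf.comp_perm (Equiv.swap 0 i)) (fun j => h₁ _) (fun j => h₂ _)
      (fun j => h₃ _) 0 rfl
  subst hi
  wlog hw : ‖w₁‖ = 1 generalizing w₁
  · by_cases h0 : w₁ = 0
    · rw [Phi_swap_left, h0]
      simpa using Phi_add_smul_left 0 0 (f 0) w₂ w₃ 1
    · have := this (w₁ := ‖w₁‖⁻¹ • w₁) (fun i => by rw [real_inner_smul_left, h₁, mul_zero])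
        (norm_smul_inv_norm (𝕜 := ℝ) h0)
      rw [Phi_swap_left, ← inner_crossTriple, real_inner_smul_left, inner_crossTriple] at this
      rw [Phi_swap_left]
      simpa [h0] using this
  obtain ⟨b, hb⟩ := hf.exists_orthonormalBasis h₁ hw
  have h : Phi (f 0) w₁ w₂ w₃ = ⟪w₂, crossTriple (f 0) w₁ w₃⟫ := by
    rw [inner_crossTriple, Phi_swap_left (f 0) w₂, Phi_swap_mid (f 0) w₁ w₂, neg_neg]
  rw [h, ← b.sum_inner_mul_inner, hb]
  have hJ : ∀ i : Fin 3, (⟪crossTriple (f 0) w₁ (f i.succ), crossTriple (f 0) w₁ w₃⟫ : ℝ) = 0 :=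
    fun i => by
      rw [inner_crossTriple_crossTriple (hf.1.1 0) hw (by rw [real_inner_comm, h₁])
        (hf.1.2 (Fin.succ_ne_zero i).symm) (h₁ _), real_inner_comm, h₃]
  have hJw : (⟪w₁, crossTriple (f 0) w₁ w₃⟫ : ℝ) = 0 := by
    rw [inner_crossTriple, Phi_swap_mid, Phi_self_left, neg_zero]
  refine Fintype.sum_eq_zero _ ?_
  rintro (i | i)
  · simp [h₂]
  · refine Fin.cases ?_ (fun i => ?_) i
    · simp [hJw]
    · simp [hJ]

lemma IsCayleyFrame.eq_zero_of_Phi_eq_zero {f : Fin 4 → E8} (hf : IsCayleyFrame f) {w z : E8}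
    (hw : ∀ i, (⟪w, f i⟫ : ℝ) = 0) (hw1 : ‖w‖ = 1) (hz : ∀ i, (⟪z, f i⟫ : ℝ) = 0)
    (hwz : (⟪w, z⟫ : ℝ) = 0) (h : ∀ i : Fin 3, Phi (f i.succ) (f 0) w z = 0) : z = 0 := by
  obtain ⟨b, hb⟩ := hf.exists_orthonormalBasis hw hw1
  have hJ : ∀ i : Fin 3, (⟪crossTriple (f 0) w (f i.succ), z⟫ : ℝ) = 0 := fun i => by
    rw [real_inner_comm, inner_crossTriple, Phi_swap_left (f 0) z,
      Phi_swap_right (f 0) z (f i.succ) w, Phi_swap_mid (f 0) (f i.succ) z w,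
      Phi_swap_left (f i.succ) (f 0), Phi_swap_right (f i.succ) (f 0) w z, h i]
    norm_num
  rw [← b.sum_repr' z, hb]
  refine Fintype.sum_eq_zero _ ?_
  rintro (i | i)
  · rw [Sum.elim_inl, real_inner_comm, hz, zero_smul]
  · refine Fin.cases ?_ (fun i => ?_) i
    · simp [hwz]
    · simp [hJ]

lemma orthonormal_cons {n : ℕ} {u : E8} {b : Fin n → E8} (hu : ‖u‖ = 1) (hb : Orthonormal ℝ b)
    (hub : ∀ i, (⟪u, b i⟫ : ℝ) = 0) : Orthonormal ℝ (Fin.cons u b : Fin (n + 1) → E8) := by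
  rw [orthonormal_iff_ite] at hb ⊢
  intro i j
  refine Fin.cases ?_ (fun i => ?_) i <;> refine Fin.cases ?_ (fun j => ?_) j
  · simp [hu]
  · simpa [(Fin.succ_ne_zero j).symm] using hub j
  · simpa [real_inner_comm] using hub i
  · simpa using hb i j

/-- The Cayley form vanishes on `w i + t i • c` if the `w i` are linearly dependent and it vanishes
on `c` together with any three of the `w i`. -/
lemma Phi0_eq_zero_of_normal {c : E8} {g w : Fin 4 → E8} {t : Fin 4 → ℝ}
    (hg : ∀ i, g i = w i + t i • c) (hw : ¬LinearIndependent ℝ w)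
    (h : ∀ i j k, Phi c (w i) (w j) (w k) = 0) : Phi0 g = 0 := by
  have h0 : Phi (w 0) (w 1) (w 2) (w 3) = 0 := by
    have := PhiAlternating.map_linearDependent w hw
    rw [PhiAlternating_apply] at this
    rw [← this, Phi]; congr 1; ext i : 1; fin_cases i <;> rfl
  have hP : Phi0 g = Phi (w 0 + t 0 • c) (w 1 + t 1 • c) (w 2 + t 2 • c) (w 3 + t 3 • c) := by
    rw [Phi]; congr 1; ext i : 1; fin_cases i <;> exact hg _
  have h₂ : ∀ i j k, Phi (w i) c (w j) (w k) = 0 := fun i j k => by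
    rw [Phi_swap_left, h, neg_zero]
  have h₃ : ∀ i j k, Phi (w i) (w j) c (w k) = 0 := fun i j k => by
    rw [Phi_swap_mid, h₂, neg_zero]
  have h₄ : ∀ i j k, Phi (w i) (w j) (w k) c = 0 := fun i j k => by
    rw [Phi_swap_right, h₃, neg_zero]
  have hself : ∀ x y, Phi c x c y = 0 := fun x y => by
    rw [Phi_swap_mid, Phi_self_left, neg_zero]
  have hself' : ∀ x y, Phi x c y c = 0 := fun x y => by
    rw [Phi_swap_mid, Phi_self_right, neg_zero]
  have hself'' : ∀ x y, Phi c x y c = 0 := fun x y => by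
    rw [Phi_swap_right, hself, neg_zero]
  rw [hP]
  simp only [Phi_add_smul_left, Phi_add_smul_second, Phi_add_smul_third, Phi_add_smul_right,
    h0, h, h₂, h₃, h₄, hself, hself', hself'', Phi_self_left, Phi_self_mid, Phi_self_right]
  ring

lemma exists_mem_unit_inner_eq_zero {S T : Submodule ℝ E8} (hST : S ≤ T)
    (h : Module.finrank ℝ S < Module.finrank ℝ T) :
    ∃ x ∈ T, ‖x‖ = 1 ∧ ∀ y ∈ S, (⟪y, x⟫ : ℝ) = 0 := by
  have hdim := Submodule.finrank_add_inf_finrank_orthogonal hST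
  obtain ⟨⟨x, hx⟩, hx0⟩ :=
    Module.finrank_pos_iff_exists_ne_zero.mp (show 0 < Module.finrank ℝ ↥(Sᗮ ⊓ T) by omega)
  have hx0' : x ≠ 0 := fun h => hx0 (Subtype.ext h)
  refine ⟨‖x‖⁻¹ • x, T.smul_mem _ hx.2, norm_smul_inv_norm (𝕜 := ℝ) hx0', fun y hy => ?_⟩
  rw [inner_smul_right, hx.1 y hy, mul_zero]

lemma finrank_span_range {n : ℕ} {v : Fin n → E8} (hv : LinearIndependent ℝ v) :
    Module.finrank ℝ (Submodule.span ℝ (Set.range v)) = n := by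
  simpa using finrank_span_eq_card hv

lemma span_range_le {n : ℕ} {v : Fin n → E8} {S : Submodule ℝ E8} (h : ∀ i, v i ∈ S) :
    Submodule.span ℝ (Set.range v) ≤ S :=
  Submodule.span_le.mpr (Set.range_subset_iff.mpr h)

/-- A Cayley subspace `X` meets a 6-dimensional subspace `W` (along a 3-dimensional
subspace `B ⊆ X ∩ W`) orthogonally if and only if the 2-form `ω = −∗_W(Φ₀|_W)`
vanishes on `B`, expressed as: for all orthonormal `a, b ∈ B` and every orthonormal
basis `(g₁,g₂,g₃,g₄)` of the orthogonal complement of `span{a,b}` in `W`,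
`Φ₀(g₁,g₂,g₃,g₄) = 0`. -/
theorem cayley_meets_orthogonally_iff_omega_vanishes
    (X W B : Submodule ℝ E8) (hX : IsCayley X)
    (hWdim : Module.finrank ℝ W = 6)
    (hB : B ≤ X ⊓ W) (hBdim : Module.finrank ℝ B = 3)
    (u : E8) (huX : u ∈ X) (hu : ‖u‖ = 1) (huB : ∀ b ∈ B, (⟪u, b⟫ : ℝ) = 0) :
    (∀ w ∈ W, (⟪u, w⟫ : ℝ) = 0) ↔
      ∀ a b : E8, a ∈ B → b ∈ B → Orthonormal ℝ ![a, b] →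
        ∀ g : Fin 4 → E8, (∀ i, g i ∈ W) → Orthonormal ℝ g →
          (∀ i, (⟪g i, a⟫ : ℝ) = 0 ∧ (⟪g i, b⟫ : ℝ) = 0) →
          Phi0 g = 0 := by
  have hframe : ∀ b : Fin 3 → E8, (∀ i, b i ∈ B) → Orthonormal ℝ b →
      IsCayleyFrame (Fin.cons u b : Fin 4 → E8) := by
    intro b hbB hb
    refine hX.isCayleyFrame (fun i => ?_) (orthonormal_cons hu hb fun i => huB _ (hbB i))
    refine Fin.cases huX (fun i => (hB (hbB i)).1) i
  constructor
  · intro huW a b ha hb hab g hgW hg hgab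
    obtain ⟨c, hcB, hc1, hc⟩ := exists_mem_unit_inner_eq_zero
      (span_range_le (v := ![a, b]) (S := B) (by simp [Fin.forall_fin_two, ha, hb]))
      (by rw [finrank_span_range hab.linearIndependent, hBdim]; norm_num)
    have hcab : Orthonormal ℝ (Fin.cons c ![a, b] : Fin 3 → E8) :=
      orthonormal_cons hc1 hab fun i => by
        rw [real_inner_comm]; exact hc _ (Submodule.subset_span ⟨i, rfl⟩)
    have hcabB : ∀ i, (Fin.cons c ![a, b] : Fin 3 → E8) i ∈ B := by
      simp [Fin.forall_fin_succ, ha, hb, hcB]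
    have hf := hframe _ hcabB hcab
    set w : Fin 4 → E8 := fun i => g i - (⟪g i, c⟫ : ℝ) • c with hw_def
    have hwW : ∀ i, w i ∈ W := fun i =>
      W.sub_mem (hgW i) (W.smul_mem _ (hB hcB).2)
    have hwb : ∀ i j, (⟪w i, (Fin.cons c ![a, b] : Fin 3 → E8) j⟫ : ℝ) = 0 := by
      intro i j
      have h1 := hcab.2 (show (0 : Fin 3) ≠ 1 by decide)
      have h2 := hcab.2 (show (0 : Fin 3) ≠ 2 by decide)
      simp only [Fin.isValue, Fin.cons_zero, Fin.cons_one, Matrix.cons_val_zero] at h1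
      change (⟪c, b⟫ : ℝ) = 0 at h2
      rw [hw_def, inner_sub_left, real_inner_smul_left]
      fin_cases j
      · simp [hc1]
      · simp [h1, (hgab i).1]
      · change (⟪g i, b⟫ : ℝ) - ⟪g i, c⟫ * ⟪c, b⟫ = 0
        rw [h2, (hgab i).2]; simp
    have hwf : ∀ i j, (⟪w i, (Fin.cons u (Fin.cons c ![a, b] : Fin 3 → E8) : Fin 4 → E8) j⟫ : ℝ)
        = 0 := by
      intro i j
      refine Fin.cases ?_ (fun j => ?_) j
      · rw [Fin.cons_zero, real_inner_comm]; exact huW _ (hwW i)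
      · rw [Fin.cons_succ]; exact hwb i j
    refine Phi0_eq_zero_of_normal (c := c) (w := w) (t := fun i => ⟪g i, c⟫)
      (fun i => by simp [hw_def]) (fun hli => ?_)
      (fun i j k => hf.Phi_normal_eq_zero (hwf i) (hwf j) (hwf k) 1)
    have hS := Submodule.finrank_add_inf_finrank_orthogonal
      (span_range_le (S := W) fun i => (hB (hcabB i)).2)
    rw [finrank_span_range hcab.linearIndependent, hWdim] at hS
    have hle := Submodule.finrank_mono (span_range_le (v := w)
      (S := (Submodule.span ℝ (Set.range (Fin.cons c ![a, b] : Fin 3 → E8)))ᗮ ⊓ W) fun i =>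
        ⟨(Submodule.mem_orthogonal' _ _).mpr fun y hy => by
          have : Submodule.span ℝ (Set.range (Fin.cons c ![a, b] : Fin 3 → E8)) ≤
              (ℝ ∙ w i)ᗮ := span_range_le fun j =>
            Submodule.mem_orthogonal_singleton_iff_inner_right.mpr (hwb i j)
          exact Submodule.mem_orthogonal_singleton_iff_inner_right.mp (this hy), hwW i⟩)
    rw [finrank_span_range hli] at hle
    omega
  · intro h
    by_contra! hne
    obtain ⟨w₀, hw₀, hw₀u⟩ := hne
    set p := W.starProjection u with hp_def
    have hpW : p ∈ W := W.starProjection_apply_mem u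
    have hpu : ∀ x ∈ W, (⟪p, x⟫ : ℝ) = ⟪u, x⟫ := fun x hx => by
      have := W.starProjection_inner_eq_zero u x hx
      rw [inner_sub_left, sub_eq_zero] at this
      exact this.symm
    have hp0 : p ≠ 0 := fun h0 => hw₀u (by rw [← hpu _ hw₀, h0, inner_zero_left])
    obtain ⟨β⟩ : Nonempty (OrthonormalBasis (Fin 3) ℝ B) :=
      ⟨(stdOrthonormalBasis ℝ B).reindex (finCongr hBdim)⟩
    set b : Fin 3 → E8 := fun i => β i with hb_def
    have hbB : ∀ i, b i ∈ B := fun i => (β i).2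
    have hb : Orthonormal ℝ b := B.subtypeₗᵢ.orthonormal_comp_iff.mpr β.orthonormal
    have hf := hframe b hbB hb
    set w₁ := ‖p‖⁻¹ • p with hw₁_def
    have hw₁W : w₁ ∈ W := W.smul_mem _ hpW
    have hw₁1 : ‖w₁‖ = 1 := norm_smul_inv_norm (𝕜 := ℝ) hp0
    have hw₁u : ∀ x ∈ W, (⟪u, x⟫ : ℝ) = ‖p‖ * ⟪w₁, x⟫ := fun x hx => by
      rw [← hpu x hx, hw₁_def, real_inner_smul_left, mul_inv_cancel_left₀ (norm_ne_zero_iff.mpr hp0)]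
    have hw₁b : ∀ i, (⟪w₁, b i⟫ : ℝ) = 0 := fun i => by
      rw [hw₁_def, real_inner_smul_left, hpu _ (hB (hbB i)).2, huB _ (hbB i), mul_zero]
    clear_value w₁
    have hs₁ := orthonormal_cons hw₁1 hb hw₁b
    have hs₁W : ∀ i, (Fin.cons w₁ b : Fin 4 → E8) i ∈ W := fun i =>
      Fin.cases hw₁W (fun i => (hB (hbB i)).2) i
    obtain ⟨w₂, hw₂W, hw₂1, hw₂⟩ := exists_mem_unit_inner_eq_zero (span_range_le hs₁W)
      (by rw [finrank_span_range hs₁.linearIndependent, hWdim]; norm_num)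
    have hs₂ := orthonormal_cons hw₂1 hs₁ fun i => by
      rw [real_inner_comm]; exact hw₂ _ (Submodule.subset_span ⟨i, rfl⟩)
    have hs₂W : ∀ i, (Fin.cons w₂ (Fin.cons w₁ b : Fin 4 → E8) : Fin 5 → E8) i ∈ W := fun i =>
      Fin.cases hw₂W (fun i => hs₁W i) i
    obtain ⟨w₃, hw₃W, hw₃1, hw₃⟩ := exists_mem_unit_inner_eq_zero (span_range_le hs₂W)
      (by rw [finrank_span_range hs₂.linearIndependent, hWdim]; norm_num)
    have hs₃ := orthonormal_cons hw₃1 hs₂ fun i => by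
      rw [real_inner_comm]; exact hw₃ _ (Submodule.subset_span ⟨i, rfl⟩)
    have hw₁w₂ : (⟪w₁, w₂⟫ : ℝ) = 0 := hs₃.2 (show (2 : Fin 6) ≠ 1 by decide)
    have hw₁w₃ : (⟪w₁, w₃⟫ : ℝ) = 0 := hs₃.2 (show (2 : Fin 6) ≠ 0 by decide)
    have hw₂f : ∀ i, (⟪w₂, (Fin.cons u b : Fin 4 → E8) i⟫ : ℝ) = 0 := by
      refine Fin.cases ?_ fun i => ?_
      · rw [Fin.cons_zero, real_inner_comm, hw₁u _ hw₂W, hw₁w₂, mul_zero]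
      · exact hs₂.2 (Fin.succ_ne_zero i.succ).symm
    have hw₃f : ∀ i, (⟪w₃, (Fin.cons u b : Fin 4 → E8) i⟫ : ℝ) = 0 := by
      refine Fin.cases ?_ fun i => ?_
      · rw [Fin.cons_zero, real_inner_comm, hw₁u _ hw₃W, hw₁w₃, mul_zero]
      · exact hs₃.2 (Fin.succ_ne_zero i.succ.succ).symm
    have hw₂w₃ : (⟪w₂, w₃⟫ : ℝ) = 0 := hs₃.2 (show (1 : Fin 6) ≠ 0 by decide)
    have hα : (⟪w₁, u⟫ : ℝ) = ‖p‖ := by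
      rw [real_inner_comm, hw₁u _ hw₁W, real_inner_self_eq_norm_sq, hw₁1]; ring
    have hmf : ∀ i, (⟪w₁ - ‖p‖ • u, (Fin.cons u b : Fin 4 → E8) i⟫ : ℝ) = 0 := by
      refine Fin.cases ?_ fun i => ?_
      · rw [Fin.cons_zero, inner_sub_left, real_inner_smul_left, hα, real_inner_self_eq_norm_sq, hu]
        ring
      · rw [Fin.cons_succ, inner_sub_left, real_inner_smul_left, hw₁b, huB _ (hbB i)]
        ring
    have hw₃0 : w₃ = 0 := by
      refine hf.eq_zero_of_Phi_eq_zero hw₂f hw₂1 hw₃f hw₂w₃ fun i => ?_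
      rw [Fin.cons_succ, Fin.cons_zero]
      have hΦ : Phi (b i) w₁ w₂ w₃ = 0 := by
        obtain ⟨j, k, hij, hik, hjk⟩ : ∃ j k : Fin 3, i ≠ j ∧ i ≠ k ∧ j ≠ k := by
          revert i; decide
        have hσ : Function.Injective ![j.succ.succ.succ, k.succ.succ.succ] := by
          rw [← List.nodup_ofFn]; simpa using hjk
        have hτ : ∀ i : Fin 3, Function.Injective ![i.succ.succ.succ, 2, 1, 0] := by decide
        have hm := hs₃.comp _ (hτ i)
        have hm' : (Fin.cons w₃ (Fin.cons w₂ (Fin.cons w₁ b : Fin 4 → E8) : Fin 5 → E8) :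
            Fin 6 → E8) ∘ ![i.succ.succ.succ, 2, 1, 0] = ![b i, w₁, w₂, w₃] := by
          ext l : 1; fin_cases l <;> rfl
        have ho := hs₃.comp _ hσ
        have ho' : (Fin.cons w₃ (Fin.cons w₂ (Fin.cons w₁ b : Fin 4 → E8) : Fin 5 → E8) :
            Fin 6 → E8) ∘ ![j.succ.succ.succ, k.succ.succ.succ] = ![b j, b k] := by
          ext l : 1; fin_cases l <;> rfl
        rw [hm'] at hm
        rw [ho'] at ho
        refine h (b j) (b k) (hbB j) (hbB k) ho _ ?_ hm ?_
        · simpa [Fin.forall_fin_succ, hw₁W, hw₂W, hw₃W] using (hB (hbB i)).2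
        · simp only [Fin.forall_fin_succ, Fin.forall_fin_zero]
          exact ⟨⟨hb.2 hij, hb.2 hik⟩, ⟨hw₁b j, hw₁b k⟩, ⟨hw₂f j.succ, hw₂f k.succ⟩,
            ⟨hw₃f j.succ, hw₃f k.succ⟩, trivial⟩
      have hm := hf.Phi_normal_eq_zero hmf hw₂f hw₃f i.succ
      rw [Fin.cons_succ, Phi_swap_left, sub_eq_add_neg, ← neg_smul, Phi_add_smul_left,
        Phi_swap_left (b i) w₁, hΦ, Phi_swap_left (b i) u] at hm
      simpa [hp0] using hm
    simp [hw₃0] at hw₃1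

end
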